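/- For every ξ = (ξ₀,ξ₁,ξ₂,ξ₃) ∈ ℝ⁴ with (ξ₁,ξ₂,ξ₃) ≠ (0,0,0), the 64×55 complex matrix B(ξ) has rank 46. -/

import Mathlib

open Matrix Complex

/-- `e i` is the `i`-th standard basis vector of `ℂ^55` (`1 ≤ i ≤ 55`, one-based). -/
def e (i : ℕ) : Fin 55 → ℂ := fun j => if (j : ℕ) + 1 = i then 1 else 0

def α₁ : Fin 55 → ℂ := e 5 + e 10
def α₂ (μ τ : ℝ) : Fin 55 → ℂ :=
  (τ : ℂ) • e 13 - (μ : ℂ) • (e 18 + e 19 + e 20) + e 47 + e 48 + e 49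
def α₃ (μ τ : ℝ) : Fin 55 → ℂ :=
  (τ : ℂ) • e 14 - (μ : ℂ) • (e 28 + e 29 + e 30) + e 50 + e 51 + e 52
def α₄ (μ τ : ℝ) : Fin 55 → ℂ :=
  (τ : ℂ) • e 15 - (μ : ℂ) • (e 38 + e 39 + e 40) + e 53 + e 54 + e 55

/-- The `16 × 55` matrix `H`. -/
def Hm (μ τ : ℝ) : Matrix (Fin 16) (Fin 55) ℂ :=
  Matrix.of ![-α₁, -α₂ μ τ, -α₃ μ τ, -α₄ μ τ, e 1, e 2, e 3, e 4, e 5, e 6, e 7, e 8,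
    e 9, e 10, e 11, e 16]

/-- The `16 × 55` matrix `H₀`. -/
def Hm0 (μ τ : ℝ) : Matrix (Fin 16) (Fin 55) ℂ :=
  Matrix.of ![e 21, e 17, e 27, e 37, e 22, e 23, -α₂ μ τ, e 31, e 32, e 33, -α₃ μ τ,
    e 41, e 42, e 43, -α₄ μ τ, e 12]

/-- The `16 × 55` matrix `H₁`. -/
def Hm1 : Matrix (Fin 16) (Fin 55) ℂ :=
  Matrix.of ![e 18, e 21, e 31, e 41, e 24, e 25, -α₁, e 28, e 34, e 35, e 4, e 38,
    e 44, e 45, e 8, e 13]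

/-- The `16 × 55` matrix `H₂`. -/
def Hm2 : Matrix (Fin 16) (Fin 55) ℂ :=
  Matrix.of ![e 24, e 22, e 32, e 42, e 19, e 26, e 1, e 34, e 29, e 36, e 5, e 44,
    e 39, e 46, e 9, e 14]

/-- The `16 × 55` matrix `H₃`. -/
def Hm3 : Matrix (Fin 16) (Fin 55) ℂ :=
  Matrix.of ![e 25, e 23, e 33, e 43, e 26, e 20, e 2, e 35, e 36, e 30, e 6, e 45,
    e 46, e 40, e 10, e 15]

/-- The four matrices `H₀, H₁, H₂, H₃`. -/
def HmB (μ τ : ℝ) : Fin 4 → Matrix (Fin 16) (Fin 55) ℂ := ![Hm0 μ τ, Hm1, Hm2, Hm3]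

/-- The `64 × 55` complex matrix `B(ξ)`, obtained by stacking the four `16 × 55` blocks
`iξ₀H − H₀`, `iξ₁H − H₁`, `iξ₂H − H₂`, `iξ₃H − H₃`. -/
noncomputable def B (μ τ : ℝ) (ξ : Fin 4 → ℝ) : Matrix (Fin 64) (Fin 55) ℂ :=
  Matrix.of fun i j =>
    Complex.I * (ξ ⟨(i : ℕ) / 16, by have := i.isLt; omega⟩ : ℂ) *
        Hm μ τ ⟨(i : ℕ) % 16, by have := i.isLt; omega⟩ j
      - HmB μ τ ⟨(i : ℕ) / 16, by have := i.isLt; omega⟩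
          ⟨(i : ℕ) % 16, by have := i.isLt; omega⟩ j


/-- Pairing with a standard basis vector reads off a coordinate. -/
lemma e_dot (n : ℕ) (x : Fin 55 → ℂ) :
    e n ⬝ᵥ x = if h : 1 ≤ n ∧ n ≤ 55 then x ⟨n - 1, by omega⟩ else 0 := by
  split_ifs with h
  · have hn : ∀ j : Fin 55, ((j : ℕ) + 1 = n) ↔ j = ⟨n - 1, by omega⟩ := by
      intro j
      rw [Fin.ext_iff]
      simp only
      omega
    simp [dotProduct, e, hn]
  · have hn : ∀ j : Fin 55, ¬ ((j : ℕ) + 1 = n) := by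
      intro j
      omega
    simp [dotProduct, e, hn]

/-- The kernel equations, block by block and row by row. -/
lemma B_ker_iff (μ τ : ℝ) (ξ : Fin 4 → ℝ) (x : Fin 55 → ℂ) :
    (B μ τ ξ) *ᵥ x = 0 ↔
      ∀ k : Fin 4, ∀ r : Fin 16, I * ξ k * (Hm μ τ r ⬝ᵥ x) = HmB μ τ k r ⬝ᵥ x := by
  have key : ∀ i : Fin 64, ((B μ τ ξ) *ᵥ x) i =
      I * (ξ ⟨(i : ℕ) / 16, by omega⟩ : ℂ) * (Hm μ τ ⟨(i : ℕ) % 16, by omega⟩ ⬝ᵥ x)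
      - HmB μ τ ⟨(i : ℕ) / 16, by omega⟩ ⟨(i : ℕ) % 16, by omega⟩ ⬝ᵥ x := by
    intro i
    simp only [mulVec, dotProduct, B, Matrix.of_apply, sub_mul, Finset.sum_sub_distrib,
      Finset.mul_sum, mul_assoc]
  constructor
  · intro h k r
    have h1 := key ⟨16 * k + r, by omega⟩
    rw [h] at h1
    have hk : (⟨(16 * (k : ℕ) + r) / 16, by omega⟩ : Fin 4) = k := by
      ext; simp only; omega
    have hr : (⟨(16 * (k : ℕ) + r) % 16, by omega⟩ : Fin 16) = r := by
      ext; simp only; omega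
    simp only [hk, hr, Pi.zero_apply] at h1
    exact (sub_eq_zero.mp h1.symm)
  · intro h
    ext i
    rw [key i, h]
    simp

/-- Coordinate forms of the functionals `α₁, …, α₄`. -/
def al1 (x : Fin 55 → ℂ) : ℂ := x 4 + x 9
def al2 (μ τ : ℝ) (x : Fin 55 → ℂ) : ℂ :=
  τ * x 12 - μ * (x 17 + x 18 + x 19) + x 46 + x 47 + x 48
def al3 (μ τ : ℝ) (x : Fin 55 → ℂ) : ℂ :=
  τ * x 13 - μ * (x 27 + x 28 + x 29) + x 49 + x 50 + x 51
def al4 (μ τ : ℝ) (x : Fin 55 → ℂ) : ℂ :=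
  τ * x 14 - μ * (x 37 + x 38 + x 39) + x 52 + x 53 + x 54

lemma e_dot_fin (n : Fin 55) (x : Fin 55 → ℂ) : e ((n : ℕ) + 1) ⬝ᵥ x = x n := by
  rw [e_dot, dif_pos (by omega)]
  rfl

lemma α₁_dot (x : Fin 55 → ℂ) : α₁ ⬝ᵥ x = al1 x := by
  rw [α₁, add_dotProduct]
  exact congrArg₂ (· + ·) (e_dot_fin 4 x) (e_dot_fin 9 x)

lemma comb_dot (t m : ℂ) (a b c d f g h : Fin 55) (x : Fin 55 → ℂ) :
    (t • e ((a : ℕ) + 1) - m • (e ((b : ℕ) + 1) + e ((c : ℕ) + 1) + e ((d : ℕ) + 1))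
      + e ((f : ℕ) + 1) + e ((g : ℕ) + 1) + e ((h : ℕ) + 1)) ⬝ᵥ x =
    t * x a - m * (x b + x c + x d) + x f + x g + x h := by
  simp only [add_dotProduct, sub_dotProduct, smul_dotProduct, e_dot_fin, smul_eq_mul]

lemma α₂_dot (μ τ : ℝ) (x : Fin 55 → ℂ) : α₂ μ τ ⬝ᵥ x = al2 μ τ x :=
  comb_dot τ μ 12 17 18 19 46 47 48 x

lemma α₃_dot (μ τ : ℝ) (x : Fin 55 → ℂ) : α₃ μ τ ⬝ᵥ x = al3 μ τ x :=
  comb_dot τ μ 13 27 28 29 49 50 51 x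

lemma α₄_dot (μ τ : ℝ) (x : Fin 55 → ℂ) : α₄ μ τ ⬝ᵥ x = al4 μ τ x :=
  comb_dot τ μ 14 37 38 39 52 53 54 x

/-- Coordinate forms of the rows of the five blocks. -/
def hv (μ τ : ℝ) (x : Fin 55 → ℂ) : Fin 16 → ℂ := ![-al1 x, -al2 μ τ x, -al3 μ τ x, -al4 μ τ x, x 0, x 1, x 2, x 3, x 4, x 5, x 6, x 7, x 8, x 9, x 10, x 15]
def hvB (μ τ : ℝ) (x : Fin 55 → ℂ) : Fin 4 → Fin 16 → ℂ :=
  ![![x 20, x 16, x 26, x 36, x 21, x 22, -al2 μ τ x, x 30, x 31, x 32, -al3 μ τ x, x 40, x 41, x 42, -al4 μ τ x, x 11],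
    ![x 17, x 20, x 30, x 40, x 23, x 24, -al1 x, x 27, x 33, x 34, x 3, x 37, x 43, x 44, x 7, x 12],
    ![x 23, x 21, x 31, x 41, x 18, x 25, x 0, x 33, x 28, x 35, x 4, x 43, x 38, x 45, x 8, x 13],
    ![x 24, x 22, x 32, x 42, x 25, x 19, x 1, x 34, x 35, x 29, x 5, x 44, x 45, x 39, x 9, x 14]]

lemma neg_dot_of {u x : Fin 55 → ℂ} {c : ℂ} (h : u ⬝ᵥ x = c) : (-u) ⬝ᵥ x = -c := by
  rw [neg_dotProduct, h]

lemma Hm_dot (μ τ : ℝ) (x : Fin 55 → ℂ) (r : Fin 16) : Hm μ τ r ⬝ᵥ x = hv μ τ x r := by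
  fin_cases r
  · exact neg_dot_of (α₁_dot x)
  · exact neg_dot_of (α₂_dot μ τ x)
  · exact neg_dot_of (α₃_dot μ τ x)
  · exact neg_dot_of (α₄_dot μ τ x)
  · exact e_dot_fin 0 x
  · exact e_dot_fin 1 x
  · exact e_dot_fin 2 x
  · exact e_dot_fin 3 x
  · exact e_dot_fin 4 x
  · exact e_dot_fin 5 x
  · exact e_dot_fin 6 x
  · exact e_dot_fin 7 x
  · exact e_dot_fin 8 x
  · exact e_dot_fin 9 x
  · exact e_dot_fin 10 x
  · exact e_dot_fin 15 x

lemma HmB_dot (μ τ : ℝ) (x : Fin 55 → ℂ) (k : Fin 4) (r : Fin 16) :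
    HmB μ τ k r ⬝ᵥ x = hvB μ τ x k r := by
  fin_cases k <;> fin_cases r
  · exact e_dot_fin 20 x
  · exact e_dot_fin 16 x
  · exact e_dot_fin 26 x
  · exact e_dot_fin 36 x
  · exact e_dot_fin 21 x
  · exact e_dot_fin 22 x
  · exact neg_dot_of (α₂_dot μ τ x)
  · exact e_dot_fin 30 x
  · exact e_dot_fin 31 x
  · exact e_dot_fin 32 x
  · exact neg_dot_of (α₃_dot μ τ x)
  · exact e_dot_fin 40 x
  · exact e_dot_fin 41 x
  · exact e_dot_fin 42 x
  · exact neg_dot_of (α₄_dot μ τ x)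
  · exact e_dot_fin 11 x
  · exact e_dot_fin 17 x
  · exact e_dot_fin 20 x
  · exact e_dot_fin 30 x
  · exact e_dot_fin 40 x
  · exact e_dot_fin 23 x
  · exact e_dot_fin 24 x
  · exact neg_dot_of (α₁_dot x)
  · exact e_dot_fin 27 x
  · exact e_dot_fin 33 x
  · exact e_dot_fin 34 x
  · exact e_dot_fin 3 x
  · exact e_dot_fin 37 x
  · exact e_dot_fin 43 x
  · exact e_dot_fin 44 x
  · exact e_dot_fin 7 x
  · exact e_dot_fin 12 x
  · exact e_dot_fin 23 x
  · exact e_dot_fin 21 x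
  · exact e_dot_fin 31 x
  · exact e_dot_fin 41 x
  · exact e_dot_fin 18 x
  · exact e_dot_fin 25 x
  · exact e_dot_fin 0 x
  · exact e_dot_fin 33 x
  · exact e_dot_fin 28 x
  · exact e_dot_fin 35 x
  · exact e_dot_fin 4 x
  · exact e_dot_fin 43 x
  · exact e_dot_fin 38 x
  · exact e_dot_fin 45 x
  · exact e_dot_fin 8 x
  · exact e_dot_fin 13 x
  · exact e_dot_fin 24 x
  · exact e_dot_fin 22 x
  · exact e_dot_fin 32 x
  · exact e_dot_fin 42 x
  · exact e_dot_fin 25 x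
  · exact e_dot_fin 19 x
  · exact e_dot_fin 1 x
  · exact e_dot_fin 34 x
  · exact e_dot_fin 35 x
  · exact e_dot_fin 29 x
  · exact e_dot_fin 5 x
  · exact e_dot_fin 44 x
  · exact e_dot_fin 45 x
  · exact e_dot_fin 39 x
  · exact e_dot_fin 9 x
  · exact e_dot_fin 14 x

lemma B_ker_iff' (μ τ : ℝ) (ξ : Fin 4 → ℝ) (x : Fin 55 → ℂ) :
    (B μ τ ξ) *ᵥ x = 0 ↔ ∀ k r, I * ξ k * hv μ τ x r = hvB μ τ x k r := by
  rw [B_ker_iff]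
  simp only [Hm_dot, HmB_dot]

/-- Parametrization of solutions. -/
noncomputable def par (μ τ : ℝ) (ξ : Fin 4 → ℝ) (w : Fin 10 → ℂ) : Fin 55 → ℂ :=
  ![I * ξ 2 * w 0,
    I * ξ 3 * w 0,
    w 0,
    I * ξ 1 * w 1,
    I * ξ 2 * w 1,
    I * ξ 3 * w 1,
    w 1,
    I * ξ 1 * w 2,
    I * ξ 2 * w 2,
    I * ξ 3 * w 2,
    w 2,
    I * ξ 0 * w 3,
    I * ξ 1 * w 3,
    I * ξ 2 * w 3,
    I * ξ 3 * w 3,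
    w 3,
    I * ξ 0 * (I * ξ 0 * w 0),
    I * ξ 1 * (I * ξ 1 * w 0),
    I * ξ 2 * (I * ξ 2 * w 0),
    I * ξ 3 * (I * ξ 3 * w 0),
    I * ξ 0 * (I * ξ 1 * w 0),
    I * ξ 0 * (I * ξ 2 * w 0),
    I * ξ 0 * (I * ξ 3 * w 0),
    I * ξ 1 * (I * ξ 2 * w 0),
    I * ξ 1 * (I * ξ 3 * w 0),
    I * ξ 2 * (I * ξ 3 * w 0),
    I * ξ 0 * (I * ξ 0 * w 1),
    I * ξ 1 * (I * ξ 1 * w 1),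
    I * ξ 2 * (I * ξ 2 * w 1),
    I * ξ 3 * (I * ξ 3 * w 1),
    I * ξ 0 * (I * ξ 1 * w 1),
    I * ξ 0 * (I * ξ 2 * w 1),
    I * ξ 0 * (I * ξ 3 * w 1),
    I * ξ 1 * (I * ξ 2 * w 1),
    I * ξ 1 * (I * ξ 3 * w 1),
    I * ξ 2 * (I * ξ 3 * w 1),
    I * ξ 0 * (I * ξ 0 * w 2),
    I * ξ 1 * (I * ξ 1 * w 2),
    I * ξ 2 * (I * ξ 2 * w 2),
    I * ξ 3 * (I * ξ 3 * w 2),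
    I * ξ 0 * (I * ξ 1 * w 2),
    I * ξ 0 * (I * ξ 2 * w 2),
    I * ξ 0 * (I * ξ 3 * w 2),
    I * ξ 1 * (I * ξ 2 * w 2),
    I * ξ 1 * (I * ξ 3 * w 2),
    I * ξ 2 * (I * ξ 3 * w 2),
    -(I * ξ 0 * w 0) - τ * (I * ξ 1 * w 3) - μ * (ξ 1 ^ 2 + ξ 2 ^ 2 + ξ 3 ^ 2) * w 0 - w 4 - w 5,
    w 4,
    w 5,
    -(I * ξ 0 * w 1) - τ * (I * ξ 2 * w 3) - μ * (ξ 1 ^ 2 + ξ 2 ^ 2 + ξ 3 ^ 2) * w 1 - w 6 - w 7,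
    w 6,
    w 7,
    -(I * ξ 0 * w 2) - τ * (I * ξ 3 * w 3) - μ * (ξ 1 ^ 2 + ξ 2 ^ 2 + ξ 3 ^ 2) * w 2 - w 8 - w 9,
    w 8,
    w 9]

noncomputable def parL (μ τ : ℝ) (ξ : Fin 4 → ℝ) : (Fin 10 → ℂ) →ₗ[ℂ] (Fin 55 → ℂ) where
  toFun := par μ τ ξ
  map_add' u w := by
    ext j
    fin_cases j <;> simp [par] <;> ring
  map_smul' t w := by
    ext j
    fin_cases j <;> simp [par] <;> ring

noncomputable def divL (ξ : Fin 4 → ℝ) : (Fin 10 → ℂ) →ₗ[ℂ] ℂ where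
  toFun w := ξ 1 * w 0 + ξ 2 * w 1 + ξ 3 * w 2
  map_add' u w := by
    simp only [Pi.add_apply]; ring
  map_smul' t w := by
    simp only [Pi.smul_apply, smul_eq_mul, RingHom.id_apply]; ring

lemma parL_injective (μ τ : ℝ) (ξ : Fin 4 → ℝ) : Function.Injective (parL μ τ ξ) := by
  intro u w h
  have hh : ∀ j, par μ τ ξ u j = par μ τ ξ w j := fun j => congrFun h j
  ext j
  fin_cases j
  · simpa [par] using hh 2
  · simpa [par] using hh 6
  · simpa [par] using hh 10
  · simpa [par] using hh 15
  · simpa [par] using hh 47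
  · simpa [par] using hh 48
  · simpa [par] using hh 50
  · simpa [par] using hh 51
  · simpa [par] using hh 53
  · simpa [par] using hh 54

lemma par_mem (μ τ : ℝ) (ξ : Fin 4 → ℝ) (w : Fin 10 → ℂ)
    (hw : (ξ 1 : ℂ) * w 0 + ξ 2 * w 1 + ξ 3 * w 2 = 0) :
    (B μ τ ξ) *ᵥ (par μ τ ξ w) = 0 := by
  rw [B_ker_iff']
  have hI : I ^ 2 = -1 := I_sq
  obtain ⟨y, hy⟩ : ∃ y, y = par μ τ ξ w := ⟨_, rfl⟩
  have q1 : y 0 = I * ξ 2 * w 0 := by rw [hy]; rfl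
  have q2 : y 1 = I * ξ 3 * w 0 := by rw [hy]; rfl
  have q3 : y 2 = w 0 := by rw [hy]; rfl
  have q4 : y 3 = I * ξ 1 * w 1 := by rw [hy]; rfl
  have q5 : y 4 = I * ξ 2 * w 1 := by rw [hy]; rfl
  have q6 : y 5 = I * ξ 3 * w 1 := by rw [hy]; rfl
  have q7 : y 6 = w 1 := by rw [hy]; rfl
  have q8 : y 7 = I * ξ 1 * w 2 := by rw [hy]; rfl
  have q9 : y 8 = I * ξ 2 * w 2 := by rw [hy]; rfl
  have q10 : y 9 = I * ξ 3 * w 2 := by rw [hy]; rfl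
  have q11 : y 10 = w 2 := by rw [hy]; rfl
  have q12 : y 11 = I * ξ 0 * w 3 := by rw [hy]; rfl
  have q13 : y 12 = I * ξ 1 * w 3 := by rw [hy]; rfl
  have q14 : y 13 = I * ξ 2 * w 3 := by rw [hy]; rfl
  have q15 : y 14 = I * ξ 3 * w 3 := by rw [hy]; rfl
  have q16 : y 15 = w 3 := by rw [hy]; rfl
  have q17 : y 16 = I * ξ 0 * (I * ξ 0 * w 0) := by rw [hy]; rfl
  have q18 : y 17 = I * ξ 1 * (I * ξ 1 * w 0) := by rw [hy]; rfl
  have q19 : y 18 = I * ξ 2 * (I * ξ 2 * w 0) := by rw [hy]; rfl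
  have q20 : y 19 = I * ξ 3 * (I * ξ 3 * w 0) := by rw [hy]; rfl
  have q21 : y 20 = I * ξ 0 * (I * ξ 1 * w 0) := by rw [hy]; rfl
  have q22 : y 21 = I * ξ 0 * (I * ξ 2 * w 0) := by rw [hy]; rfl
  have q23 : y 22 = I * ξ 0 * (I * ξ 3 * w 0) := by rw [hy]; rfl
  have q24 : y 23 = I * ξ 1 * (I * ξ 2 * w 0) := by rw [hy]; rfl
  have q25 : y 24 = I * ξ 1 * (I * ξ 3 * w 0) := by rw [hy]; rfl
  have q26 : y 25 = I * ξ 2 * (I * ξ 3 * w 0) := by rw [hy]; rfl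
  have q27 : y 26 = I * ξ 0 * (I * ξ 0 * w 1) := by rw [hy]; rfl
  have q28 : y 27 = I * ξ 1 * (I * ξ 1 * w 1) := by rw [hy]; rfl
  have q29 : y 28 = I * ξ 2 * (I * ξ 2 * w 1) := by rw [hy]; rfl
  have q30 : y 29 = I * ξ 3 * (I * ξ 3 * w 1) := by rw [hy]; rfl
  have q31 : y 30 = I * ξ 0 * (I * ξ 1 * w 1) := by rw [hy]; rfl
  have q32 : y 31 = I * ξ 0 * (I * ξ 2 * w 1) := by rw [hy]; rfl
  have q33 : y 32 = I * ξ 0 * (I * ξ 3 * w 1) := by rw [hy]; rfl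
  have q34 : y 33 = I * ξ 1 * (I * ξ 2 * w 1) := by rw [hy]; rfl
  have q35 : y 34 = I * ξ 1 * (I * ξ 3 * w 1) := by rw [hy]; rfl
  have q36 : y 35 = I * ξ 2 * (I * ξ 3 * w 1) := by rw [hy]; rfl
  have q37 : y 36 = I * ξ 0 * (I * ξ 0 * w 2) := by rw [hy]; rfl
  have q38 : y 37 = I * ξ 1 * (I * ξ 1 * w 2) := by rw [hy]; rfl
  have q39 : y 38 = I * ξ 2 * (I * ξ 2 * w 2) := by rw [hy]; rfl
  have q40 : y 39 = I * ξ 3 * (I * ξ 3 * w 2) := by rw [hy]; rfl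
  have q41 : y 40 = I * ξ 0 * (I * ξ 1 * w 2) := by rw [hy]; rfl
  have q42 : y 41 = I * ξ 0 * (I * ξ 2 * w 2) := by rw [hy]; rfl
  have q43 : y 42 = I * ξ 0 * (I * ξ 3 * w 2) := by rw [hy]; rfl
  have q44 : y 43 = I * ξ 1 * (I * ξ 2 * w 2) := by rw [hy]; rfl
  have q45 : y 44 = I * ξ 1 * (I * ξ 3 * w 2) := by rw [hy]; rfl
  have q46 : y 45 = I * ξ 2 * (I * ξ 3 * w 2) := by rw [hy]; rfl
  have q47 : y 46 = -(I * ξ 0 * w 0) - τ * (I * ξ 1 * w 3) - μ * (ξ 1 ^ 2 + ξ 2 ^ 2 + ξ 3 ^ 2) * w 0 - w 4 - w 5 := by rw [hy]; rfl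
  have q48 : y 47 = w 4 := by rw [hy]; rfl
  have q49 : y 48 = w 5 := by rw [hy]; rfl
  have q50 : y 49 = -(I * ξ 0 * w 1) - τ * (I * ξ 2 * w 3) - μ * (ξ 1 ^ 2 + ξ 2 ^ 2 + ξ 3 ^ 2) * w 1 - w 6 - w 7 := by rw [hy]; rfl
  have q51 : y 50 = w 6 := by rw [hy]; rfl
  have q52 : y 51 = w 7 := by rw [hy]; rfl
  have q53 : y 52 = -(I * ξ 0 * w 2) - τ * (I * ξ 3 * w 3) - μ * (ξ 1 ^ 2 + ξ 2 ^ 2 + ξ 3 ^ 2) * w 2 - w 8 - w 9 := by rw [hy]; rfl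
  have q54 : y 53 = w 8 := by rw [hy]; rfl
  have q55 : y 54 = w 9 := by rw [hy]; rfl
  rw [← hy]
  clear hy
  have hα : al1 y = - (I * ξ 1 * w 0) := by
    simp only [al1, q5, q10]
    linear_combination I * hw
  have hα2 : al2 μ τ y = - (I * ξ 0 * w 0) := by
    simp only [al2, q13, q18, q19, q20, q47, q48, q49]
    linear_combination (-(μ : ℂ)) * (ξ 1 ^ 2 + ξ 2 ^ 2 + ξ 3 ^ 2) * w 0 * hI
  have hα3 : al3 μ τ y = - (I * ξ 0 * w 1) := by
    simp only [al3, q14, q28, q29, q30, q50, q51, q52]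
    linear_combination (-(μ : ℂ)) * (ξ 1 ^ 2 + ξ 2 ^ 2 + ξ 3 ^ 2) * w 1 * hI
  have hα4 : al4 μ τ y = - (I * ξ 0 * w 2) := by
    simp only [al4, q15, q38, q39, q40, q53, q54, q55]
    linear_combination (-(μ : ℂ)) * (ξ 1 ^ 2 + ξ 2 ^ 2 + ξ 3 ^ 2) * w 2 * hI
  intro k r
  fin_cases k <;> fin_cases r <;>
    simp [hv, hvB, hα, hα2, hα3, hα4, q1, q2, q3, q4, q5, q6, q7, q8, q9, q10, q11, q12, q13, q14, q15, q16, q17, q18, q19, q20, q21, q22, q23, q24, q25, q26, q27, q28, q29, q30, q31, q32, q33, q34, q35, q36, q37, q38, q39, q40, q41, q42, q43, q44, q45, q46] <;> ring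

lemma exists_par (μ τ : ℝ) (ξ : Fin 4 → ℝ) (x : Fin 55 → ℂ) (hx : (B μ τ ξ) *ᵥ x = 0) :
    ∃ w : Fin 10 → ℂ, (ξ 1 : ℂ) * w 0 + ξ 2 * w 1 + ξ 3 * w 2 = 0 ∧ par μ τ ξ w = x := by
  rw [B_ker_iff'] at hx
  have hI : I ^ 2 = -1 := I_sq
  have a0_0 : I * ξ 0 * (-(x 4 + x 9)) = x 20 := hx 0 0
  have a0_1 : I * ξ 0 * (-(τ * x 12 - μ * (x 17 + x 18 + x 19) + x 46 + x 47 + x 48)) = x 16 := hx 0 1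
  have a0_2 : I * ξ 0 * (-(τ * x 13 - μ * (x 27 + x 28 + x 29) + x 49 + x 50 + x 51)) = x 26 := hx 0 2
  have a0_3 : I * ξ 0 * (-(τ * x 14 - μ * (x 37 + x 38 + x 39) + x 52 + x 53 + x 54)) = x 36 := hx 0 3
  have a0_4 : I * ξ 0 * x 0 = x 21 := hx 0 4
  have a0_5 : I * ξ 0 * x 1 = x 22 := hx 0 5
  have a0_6 : I * ξ 0 * x 2 = -(τ * x 12 - μ * (x 17 + x 18 + x 19) + x 46 + x 47 + x 48) := hx 0 6
  have a0_7 : I * ξ 0 * x 3 = x 30 := hx 0 7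
  have a0_8 : I * ξ 0 * x 4 = x 31 := hx 0 8
  have a0_9 : I * ξ 0 * x 5 = x 32 := hx 0 9
  have a0_10 : I * ξ 0 * x 6 = -(τ * x 13 - μ * (x 27 + x 28 + x 29) + x 49 + x 50 + x 51) := hx 0 10
  have a0_11 : I * ξ 0 * x 7 = x 40 := hx 0 11
  have a0_12 : I * ξ 0 * x 8 = x 41 := hx 0 12
  have a0_13 : I * ξ 0 * x 9 = x 42 := hx 0 13
  have a0_14 : I * ξ 0 * x 10 = -(τ * x 14 - μ * (x 37 + x 38 + x 39) + x 52 + x 53 + x 54) := hx 0 14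
  have a0_15 : I * ξ 0 * x 15 = x 11 := hx 0 15
  have a1_0 : I * ξ 1 * (-(x 4 + x 9)) = x 17 := hx 1 0
  have a1_4 : I * ξ 1 * x 0 = x 23 := hx 1 4
  have a1_5 : I * ξ 1 * x 1 = x 24 := hx 1 5
  have a1_6 : I * ξ 1 * x 2 = -(x 4 + x 9) := hx 1 6
  have a1_7 : I * ξ 1 * x 3 = x 27 := hx 1 7
  have a1_8 : I * ξ 1 * x 4 = x 33 := hx 1 8
  have a1_9 : I * ξ 1 * x 5 = x 34 := hx 1 9
  have a1_10 : I * ξ 1 * x 6 = x 3 := hx 1 10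
  have a1_11 : I * ξ 1 * x 7 = x 37 := hx 1 11
  have a1_12 : I * ξ 1 * x 8 = x 43 := hx 1 12
  have a1_13 : I * ξ 1 * x 9 = x 44 := hx 1 13
  have a1_14 : I * ξ 1 * x 10 = x 7 := hx 1 14
  have a1_15 : I * ξ 1 * x 15 = x 12 := hx 1 15
  have a2_4 : I * ξ 2 * x 0 = x 18 := hx 2 4
  have a2_5 : I * ξ 2 * x 1 = x 25 := hx 2 5
  have a2_6 : I * ξ 2 * x 2 = x 0 := hx 2 6
  have a2_8 : I * ξ 2 * x 4 = x 28 := hx 2 8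
  have a2_9 : I * ξ 2 * x 5 = x 35 := hx 2 9
  have a2_10 : I * ξ 2 * x 6 = x 4 := hx 2 10
  have a2_12 : I * ξ 2 * x 8 = x 38 := hx 2 12
  have a2_13 : I * ξ 2 * x 9 = x 45 := hx 2 13
  have a2_14 : I * ξ 2 * x 10 = x 8 := hx 2 14
  have a2_15 : I * ξ 2 * x 15 = x 13 := hx 2 15
  have a3_5 : I * ξ 3 * x 1 = x 19 := hx 3 5
  have a3_6 : I * ξ 3 * x 2 = x 1 := hx 3 6
  have a3_9 : I * ξ 3 * x 5 = x 29 := hx 3 9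
  have a3_10 : I * ξ 3 * x 6 = x 5 := hx 3 10
  have a3_13 : I * ξ 3 * x 9 = x 39 := hx 3 13
  have a3_14 : I * ξ 3 * x 10 = x 9 := hx 3 14
  have a3_15 : I * ξ 3 * x 15 = x 14 := hx 3 15
  refine ⟨![x 2, x 6, x 10, x 15, x 47, x 48, x 50, x 51, x 53, x 54], ?_, ?_⟩
  · simp
    linear_combination (-I) * a1_6 - I * a2_10 - I * a3_14 + ((ξ 1 : ℂ) * x 2 + ξ 2 * x 6 + ξ 3 * x 10) * hI
  · ext j
    fin_cases j
    · simp [par]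
      linear_combination a2_6
    · simp [par]
      linear_combination a3_6
    · simp [par]
    · simp [par]
      linear_combination a1_10
    · simp [par]
      linear_combination a2_10
    · simp [par]
      linear_combination a3_10
    · simp [par]
    · simp [par]
      linear_combination a1_14
    · simp [par]
      linear_combination a2_14
    · simp [par]
      linear_combination a3_14
    · simp [par]
    · simp [par]
      linear_combination a0_15
    · simp [par]
      linear_combination a1_15
    · simp [par]
      linear_combination a2_15
    · simp [par]
      linear_combination a3_15
    · simp [par]
    · simp [par]
      linear_combination a0_1 + I * ξ 0 * a0_6
    · simp [par]
      linear_combination a1_0 + I * ξ 1 * a1_6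
    · simp [par]
      linear_combination a2_4 + I * ξ 2 * a2_6
    · simp [par]
      linear_combination a3_5 + I * ξ 3 * a3_6
    · simp [par]
      linear_combination a0_0 + I * ξ 0 * a1_6
    · simp [par]
      linear_combination a0_4 + I * ξ 0 * a2_6
    · simp [par]
      linear_combination a0_5 + I * ξ 0 * a3_6
    · simp [par]
      linear_combination a1_4 + I * ξ 1 * a2_6
    · simp [par]
      linear_combination a1_5 + I * ξ 1 * a3_6
    · simp [par]
      linear_combination a2_5 + I * ξ 2 * a3_6
    · simp [par]
      linear_combination a0_2 + I * ξ 0 * a0_10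
    · simp [par]
      linear_combination a1_7 + I * ξ 1 * a1_10
    · simp [par]
      linear_combination a2_8 + I * ξ 2 * a2_10
    · simp [par]
      linear_combination a3_9 + I * ξ 3 * a3_10
    · simp [par]
      linear_combination a0_7 + I * ξ 0 * a1_10
    · simp [par]
      linear_combination a0_8 + I * ξ 0 * a2_10
    · simp [par]
      linear_combination a0_9 + I * ξ 0 * a3_10
    · simp [par]
      linear_combination a1_8 + I * ξ 1 * a2_10
    · simp [par]
      linear_combination a1_9 + I * ξ 1 * a3_10
    · simp [par]
      linear_combination a2_9 + I * ξ 2 * a3_10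
    · simp [par]
      linear_combination a0_3 + I * ξ 0 * a0_14
    · simp [par]
      linear_combination a1_11 + I * ξ 1 * a1_14
    · simp [par]
      linear_combination a2_12 + I * ξ 2 * a2_14
    · simp [par]
      linear_combination a3_13 + I * ξ 3 * a3_14
    · simp [par]
      linear_combination a0_11 + I * ξ 0 * a1_14
    · simp [par]
      linear_combination a0_12 + I * ξ 0 * a2_14
    · simp [par]
      linear_combination a0_13 + I * ξ 0 * a3_14
    · simp [par]
      linear_combination a1_12 + I * ξ 1 * a2_14
    · simp [par]
      linear_combination a1_13 + I * ξ 1 * a3_14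
    · simp [par]
      linear_combination a2_13 + I * ξ 2 * a3_14
    · simp [par]
      linear_combination (-1) * a0_6 - τ * a1_15 + μ * (a1_0 + I * ξ 1 * a1_6 + a2_4 + I * ξ 2 * a2_6 + a3_5 + I * ξ 3 * a3_6) - μ * (ξ 1 ^ 2 + ξ 2 ^ 2 + ξ 3 ^ 2) * x 2 * hI
    · simp [par]
    · simp [par]
    · simp [par]
      linear_combination (-1) * a0_10 - τ * a2_15 + μ * (a1_7 + I * ξ 1 * a1_10 + a2_8 + I * ξ 2 * a2_10 + a3_9 + I * ξ 3 * a3_10) - μ * (ξ 1 ^ 2 + ξ 2 ^ 2 + ξ 3 ^ 2) * x 6 * hI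
    · simp [par]
    · simp [par]
    · simp [par]
      linear_combination (-1) * a0_14 - τ * a3_15 + μ * (a1_11 + I * ξ 1 * a1_14 + a2_12 + I * ξ 2 * a2_14 + a3_13 + I * ξ 3 * a3_14) - μ * (ξ 1 ^ 2 + ξ 2 ^ 2 + ξ 3 ^ 2) * x 10 * hI
    · simp [par]
    · simp [par]

lemma finrank_divL (ξ : Fin 4 → ℝ) (hξ : ¬(ξ 1 = 0 ∧ ξ 2 = 0 ∧ ξ 3 = 0)) :
    Module.finrank ℂ (LinearMap.ker (divL ξ)) = 9 := by
  have hs : Function.Surjective (divL ξ) := by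
    apply LinearMap.surjective
    intro h
    apply hξ
    have hh : ∀ w : Fin 10 → ℂ, (ξ 1 : ℂ) * w 0 + ξ 2 * w 1 + ξ 3 * w 2 = 0 := fun w =>
      LinearMap.congr_fun h w
    refine ⟨?_, ?_, ?_⟩
    · simpa using hh (Pi.single 0 1)
    · simpa using hh (Pi.single 1 1)
    · simpa using hh (Pi.single 2 1)
  have h1 := LinearMap.finrank_range_add_finrank_ker (divL ξ)
  rw [LinearMap.range_eq_top.mpr hs, finrank_top, Module.finrank_self,
    Module.finrank_fin_fun] at h1
  omega

theorem ker_eq (μ τ : ℝ) (ξ : Fin 4 → ℝ) :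
    LinearMap.ker (B μ τ ξ).mulVecLin = (LinearMap.ker (divL ξ)).map (parL μ τ ξ) := by
  ext x
  rw [LinearMap.mem_ker, Matrix.mulVecLin_apply, Submodule.mem_map]
  constructor
  · intro h
    obtain ⟨w, hw, rfl⟩ := exists_par μ τ ξ x h
    exact ⟨w, hw, rfl⟩
  · rintro ⟨w, hw, rfl⟩
    exact par_mem μ τ ξ w hw

/-- For every `ξ = (ξ₀, ξ₁, ξ₂, ξ₃) ∈ ℝ⁴` with `(ξ₁, ξ₂, ξ₃) ≠ (0,0,0)`,
the `64 × 55` complex matrix `B(ξ)` has rank `46`. -/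
theorem stmt4 (μ τ : ℝ) (hμ : 0 < μ) (hτ : 0 < τ)
    (ξ : Fin 4 → ℝ) (hξ : ¬(ξ 1 = 0 ∧ ξ 2 = 0 ∧ ξ 3 = 0)) :
    (B μ τ ξ).rank = 46 := by
  have h1 := LinearMap.finrank_range_add_finrank_ker (B μ τ ξ).mulVecLin
  have h2 : Module.finrank ℂ (LinearMap.ker (B μ τ ξ).mulVecLin) = 9 := by
    rw [ker_eq, ← finrank_divL ξ hξ]
    exact (LinearEquiv.finrank_eq (Submodule.equivMapOfInjective (parL μ τ ξ)
      (parL_injective μ τ ξ) (LinearMap.ker (divL ξ)))).symm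
  rw [h2, Module.finrank_fin_fun] at h1
  have h3 : (B μ τ ξ).rank = Module.finrank ℂ (LinearMap.range (B μ τ ξ).mulVecLin) := rfl
  omega
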